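/- Let e ∈ 𝕊 and let e′ = ie (or e′ = −ie), a unit vector orthogonal to e. Then for every u ∈ 𝕊: ⟨Ω(u), Ω(e)⟩ ⟨u, e⟩ + ⟨Ω(u), Ω(e′)⟩ ⟨u, e′⟩ ≥ 1/200. -/

import Mathlib

open MeasureTheory Metric Complex Filter Set
open scoped Topology ENNReal NNReal

noncomputable section

/-- The real inner product on `ℂ ≅ ℝ²`. -/
def rinner (u v : ℂ) : ℝ := u.re * v.re + u.im * v.im

/-- The geodesic distance on the unit circle `𝕊 ⊂ ℂ`. -/
def dS (u v : ℂ) : ℝ := Real.arccos (rinner u v)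

/-- The kernel `K(x) = |x| Ω(x/|x|)` (with `K 0 = 0`). -/
def Kmap (Ω : ℂ → ℂ) (x : ℂ) : ℂ := (‖x‖ : ℂ) * Ω (x / (‖x‖ : ℂ))

/-- The support of a measure on `ℂ`. -/
def spt (μ : Measure ℂ) : Set ℂ := {x : ℂ | ∀ r : ℝ, 0 < r → 0 < μ (ball x r)}

/-- Ahlfors 1-regularity with constant `C₀`. -/
def Ahlfors1 (μ : Measure ℂ) (C₀ : ℝ) : Prop :=
  ∀ x ∈ spt μ, ∀ r : ℝ, 0 < r →
    ENNReal.ofReal (C₀⁻¹ * r) ≤ μ (ball x r) ∧ μ (ball x r) ≤ ENNReal.ofReal (C₀ * r)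

/-- `Ω`-symmetry of a measure. -/
def OmegaSym (Ω : ℂ → ℂ) (μ : Measure ℂ) : Prop :=
  ∀ x ∈ spt μ, ∀ r : ℝ, 0 < r → (∫ y in ball x r, Kmap Ω (x - y) ∂μ) = 0

/-- `Ω` maps the unit circle to itself. -/
def MapsCircle (Ω : ℂ → ℂ) : Prop := ∀ u : ℂ, ‖u‖ = 1 → ‖Ω u‖ = 1

/-- `Ω` is odd on the unit circle. -/
def OddOnCircle (Ω : ℂ → ℂ) : Prop := ∀ u : ℂ, ‖u‖ = 1 → Ω (-u) = -(Ω u)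

/-- `Ω` is bi-Lipschitz with constant `1 + δ` on the circle, w.r.t. geodesic distance. -/
def BiLipOnCircle (Ω : ℂ → ℂ) (δ : ℝ) : Prop :=
  ∀ u v : ℂ, ‖u‖ = 1 → ‖v‖ = 1 →
    (1 + δ)⁻¹ * dS u v ≤ dS (Ω u) (Ω v) ∧ dS (Ω u) (Ω v) ≤ (1 + δ) * dS u v

/-- `Ω` is `C^k` as a circle map: it has a `C^k` lift `ω`. -/
def CircleCk (Ω : ℂ → ℂ) (k : ℕ) : Prop :=
  ∃ ω : ℝ → ℝ, ContDiff ℝ k ω ∧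
    ∀ t : ℝ, Ω (Complex.exp ((t : ℂ) * Complex.I)) = Complex.exp ((ω t : ℂ) * Complex.I)

/-- Affine lines in `ℂ`. -/
def IsLine (L : Set ℂ) : Prop :=
  ∃ a b : ℂ, b ≠ 0 ∧ L = {z : ℂ | ∃ t : ℝ, z = a + t • b}

lemma aux_core (δ x y R : ℝ) (hδ0 : 0 ≤ δ) (hδ1 : δ ≤ 1 / 20) (hx : 0 ≤ x) (hy : 0 ≤ y)
    (hxy : x ^ 2 + y ^ 2 = 1) (hR1 : -1 ≤ R) (hR2 : R ≤ 1)
    (h : Real.arccos R ≤ (1 + δ) * Real.arccos x) : 0.99 * x - 0.08 * y ≤ R := by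
  have ha0 := Real.arccos_nonneg x
  have ha1 : Real.arccos x ≤ Real.pi / 2 := Real.arccos_le_pi_div_two.2 hx
  have hc : Real.cos (Real.arccos x) = x := Real.cos_arccos (by linarith) (by nlinarith)
  have hs : Real.sin (Real.arccos x) = y := by
    rw [Real.sin_arccos, show 1 - x ^ 2 = y ^ 2 by linarith, Real.sqrt_sq hy]
  have hp := Real.pi_lt_d2
  have hp0 := Real.pi_pos
  set a := Real.arccos x with ha
  have ht0 : 0 ≤ δ * a := by positivity
  have ht1 : δ * a ≤ 0.08 := by nlinarith
  have h1 : Real.cos ((1 + δ) * a) ≤ Real.cos (Real.arccos R) :=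
    Real.cos_le_cos_of_nonneg_of_le_pi (Real.arccos_nonneg R) (by nlinarith) h
  rw [Real.cos_arccos hR1 hR2, show (1 + δ) * a = a + δ * a by ring, Real.cos_add, hc, hs] at h1
  have h2 : 0.99 ≤ Real.cos (δ * a) := by
    have := Real.one_sub_sq_div_two_le_cos (x := δ * a)
    nlinarith
  have h3 : Real.sin (δ * a) ≤ 0.08 := (Real.sin_le ht0).trans ht1
  nlinarith [mul_le_mul_of_nonneg_left h2 hx, mul_le_mul_of_nonneg_left h3 hy]

lemma aux_normsq (u : ℂ) (hu : ‖u‖ = 1) : u.re ^ 2 + u.im ^ 2 = 1 := by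
  have h := Complex.sq_norm u
  rw [hu, Complex.normSq_apply] at h
  linarith

lemma aux_bound (u v : ℂ) (hu : ‖u‖ = 1) (hv : ‖v‖ = 1) :
    -1 ≤ rinner u v ∧ rinner u v ≤ 1 := by
  have h1 := aux_normsq u hu
  have h2 := aux_normsq v hv
  unfold rinner
  constructor
  · nlinarith [sq_nonneg (u.re + v.re), sq_nonneg (u.im + v.im)]
  · nlinarith [sq_nonneg (u.re - v.re), sq_nonneg (u.im - v.im)]

lemma aux_neg (u v : ℂ) : rinner u (-v) = - rinner u v := by
  simp [rinner]; ring

lemma aux_signed (δ : ℝ) (hδ0 : 0 ≤ δ) (hδ1 : δ ≤ 1 / 20)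
    (Ω : ℂ → ℂ) (hmap : MapsCircle Ω) (hodd : OddOnCircle Ω)
    (hbilip : BiLipOnCircle Ω δ) (u v : ℂ) (hu : ‖u‖ = 1) (hv : ‖v‖ = 1)
    (y : ℝ) (hy : 0 ≤ y) (hxy : rinner u v ^ 2 + y ^ 2 = 1) :
    0.99 * rinner u v ^ 2 - 0.08 * (|rinner u v| * y) ≤ rinner (Ω u) (Ω v) * rinner u v := by
  rcases le_total 0 (rinner u v) with hx | hx
  · obtain ⟨hR1, hR2⟩ := aux_bound _ _ (hmap u hu) (hmap v hv)
    have := aux_core δ _ y _ hδ0 hδ1 hx hy hxy hR1 hR2 (hbilip u v hu hv).2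
    rw [abs_of_nonneg hx]
    nlinarith [mul_le_mul_of_nonneg_right this hx]
  · have hv' : ‖-v‖ = 1 := by rwa [norm_neg]
    obtain ⟨hR1, hR2⟩ := aux_bound _ _ (hmap u hu) (hmap _ hv')
    have hx' : 0 ≤ rinner u (-v) := by rw [aux_neg]; linarith
    have := aux_core δ _ y _ hδ0 hδ1 hx' hy (by rw [aux_neg]; linarith [neg_sq (rinner u v)])
      hR1 hR2 (hbilip u (-v) hu hv').2
    rw [hodd v hv, aux_neg, aux_neg] at this
    rw [abs_of_nonpos hx]
    nlinarith [mul_le_mul_of_nonneg_right this (neg_nonneg.2 hx)]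

/-- Quantitative positivity of the combined dot products:
`⟨Ω(u),Ω(e)⟩⟨u,e⟩ + ⟨Ω(u),Ω(e')⟩⟨u,e'⟩ ≥ 1/200` for `e' = ±ie`. -/
theorem stmt_19 (δ : ℝ) (hδ0 : 0 ≤ δ) (hδ1 : δ ≤ 1 / 20)
    (Ω : ℂ → ℂ) (hmap : MapsCircle Ω) (hodd : OddOnCircle Ω)
    (hbilip : BiLipOnCircle Ω δ)
    (e e' : ℂ) (he : ‖e‖ = 1)
    (he' : e' = Complex.I * e ∨ e' = -(Complex.I * e)) :
    ∀ u : ℂ, ‖u‖ = 1 →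
      1 / 200 ≤ rinner (Ω u) (Ω e) * rinner u e + rinner (Ω u) (Ω e') * rinner u e' := by
  intro u hu
  have hn : ‖e'‖ = 1 := by rcases he' with h | h <;> simp [h, he]
  have h1 := aux_normsq u hu
  have h2 := aux_normsq e he
  have hxy : rinner u e ^ 2 + rinner u e' ^ 2 = 1 := by
    have : rinner u e ^ 2 + rinner u e' ^ 2 = (u.re ^ 2 + u.im ^ 2) * (e.re ^ 2 + e.im ^ 2) := by
      rcases he' with h | h <;> simp [h, rinner] <;> ring
    rw [this, h1, h2, one_mul]
  have A := aux_signed δ hδ0 hδ1 Ω hmap hodd hbilip u e hu he |rinner u e'| (abs_nonneg _)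
    (by rwa [sq_abs])
  have B := aux_signed δ hδ0 hδ1 Ω hmap hodd hbilip u e' hu hn |rinner u e| (abs_nonneg _)
    (by rw [sq_abs]; linarith)
  nlinarith [sq_nonneg (|rinner u e| - |rinner u e'|), sq_abs (rinner u e), sq_abs (rinner u e')]
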